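/- Let d ≥ 1 and p ∈ ℕ. The ℂ-vector space P^{2p}_T := { q ∈ ℂ[x_1, …, x_d, t] : total degree of q ≤ 2p and i ∂_t q + (1/2) Δ_x q = 0 } has dimension equal to the binomial coefficient C(2p + d, d), i.e., the same dimension as the space of complex polynomials of total degree at most 2p in d variables. -/

import Mathlib

noncomputable section

open MvPolynomial

/-- The Schrödinger operator `S = i ∂_t + (1/2) Δ_x` as a `ℂ`-linear map on
`ℂ[x_1, …, x_d, t]` (variable `some ℓ` is `x_ℓ`, variable `none` is `t`). -/
def schrodingerOp (d : ℕ) :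
    MvPolynomial (Option (Fin d)) ℂ →ₗ[ℂ] MvPolynomial (Option (Fin d)) ℂ :=
  Complex.I • (pderiv (none : Option (Fin d))).toLinearMap
    + (1/2 : ℂ) • ∑ ℓ : Fin d,
        (pderiv (some ℓ : Option (Fin d))).toLinearMap ∘ₗ
          (pderiv (some ℓ : Option (Fin d))).toLinearMap

/-- The space `P^{2p}_T` of Trefftz polynomials of total degree at most `2p` in `(x, t)`. -/
def trefftzSpace (d p : ℕ) : Submodule ℂ (MvPolynomial (Option (Fin d)) ℂ) :=
  restrictTotalDegree (Option (Fin d)) ℂ (2 * p) ⊓ LinearMap.ker (schrodingerOp d)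

open Finsupp in
/-- The number of exponent vectors in `d` variables of degree at most `n` is `C(n + d, d)`. -/
theorem natCard_finsupp_degree_le (d n : ℕ) :
    Nat.card {m : Fin d →₀ ℕ // (m.sum fun _ e => e) ≤ n} = (n + d).choose d := by
  let e : {m : Fin d →₀ ℕ // (m.sum fun _ e => e) ≤ n} ≃
      {P : Option (Fin d) →₀ ℕ // (P.sum fun _ e => e) = n} :=
    { toFun := fun m => ⟨m.1.optionElim (n - m.1.sum fun _ e => e), by
        rw [Finsupp.sum_option_index _ _ (fun _ => rfl) (fun _ _ _ => rfl)]
        simp only [optionElim_apply_none, some_optionElim]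
        have := m.2
        omega⟩
      invFun := fun P => ⟨P.1.some, by
        have h := P.2
        rw [Finsupp.sum_option_index _ _ (fun _ => rfl) (fun _ _ _ => rfl)] at h
        omega⟩
      left_inv := fun m => by simp
      right_inv := fun P => by
        have h := P.2
        rw [Finsupp.sum_option_index _ _ (fun _ => rfl) (fun _ _ _ => rfl)] at h
        apply Subtype.ext
        have h' : n - (P.1.some.sum fun _ e => e) = P.1 none := by omega
        simp only [h', optionElim_some] }
  rw [Nat.card_congr (e.trans (Sym.equivNatSum (Option (Fin d)) n).symm),
    Sym.natCard_sym_eq_choose]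
  simp only [Nat.card_eq_fintype_card, Fintype.card_option, Fintype.card_fin]
  rw [show d + 1 + n - 1 = n + d by omega, Nat.choose_symm_add]

theorem finrank_restrictTotalDegree (d n : ℕ) :
    Module.finrank ℂ (restrictTotalDegree (Fin d) ℂ n) = (n + d).choose d := by
  rw [← natCard_finsupp_degree_le]
  exact Module.finrank_eq_nat_card_basis (basisRestrictSupport ℂ _)

/-- The spatial Laplacian on `ℂ[x_1, …, x_d]`. -/
def laplacianOp (d : ℕ) : MvPolynomial (Fin d) ℂ →ₗ[ℂ] MvPolynomial (Fin d) ℂ :=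
  ∑ ℓ : Fin d, (pderiv ℓ).toLinearMap ∘ₗ (pderiv ℓ).toLinearMap

theorem coeff_eq_zero_of_laplacianOp (d n k : ℕ) (f : MvPolynomial (Fin d) ℂ)
    (hf : ∀ m : Fin d →₀ ℕ, n < m.degree + 2 * k → coeff m f = 0)
    (m : Fin d →₀ ℕ) (hm : n < m.degree + 2 * (k + 1)) :
    coeff m (laplacianOp d f) = 0 := by
  simp only [laplacianOp, LinearMap.sum_apply, LinearMap.comp_apply, Derivation.coeFn_coe,
    coeff_sum, coeff_pderiv]
  refine Finset.sum_eq_zero fun ℓ _ => ?_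
  rw [hf]
  · simp
  · simp only [map_add, Finsupp.degree_single]
    omega

theorem coeff_laplacianOp_pow (d n : ℕ) (f : MvPolynomial (Fin d) ℂ)
    (hf : f.totalDegree ≤ n) (k : ℕ) (m : Fin d →₀ ℕ) (hm : n < m.degree + 2 * k) :
    coeff m ((laplacianOp d ^ k) f) = 0 := by
  induction k generalizing m with
  | zero =>
    refine coeff_eq_zero_of_totalDegree_lt (hf.trans_lt ?_)
    change _ < m.degree
    omega
  | succ k ih =>
    rw [pow_succ', Module.End.mul_apply]
    exact coeff_eq_zero_of_laplacianOp d n k _ ih m hm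

theorem schrodingerOp_apply (d : ℕ) (q : MvPolynomial (Option (Fin d)) ℂ) :
    schrodingerOp d q = Complex.I • pderiv none q
      + (1/2 : ℂ) • ∑ ℓ : Fin d, pderiv (some ℓ) (pderiv (some ℓ) q) := by
  simp [schrodingerOp]

/-- A Trefftz polynomial vanishing at `t = 0` is zero. -/
theorem eq_zero_of_schrodingerOp_eq_zero (d : ℕ) (q : MvPolynomial (Option (Fin d)) ℂ)
    (hq : schrodingerOp d q = 0)
    (h0 : ∀ m : Option (Fin d) →₀ ℕ, m none = 0 → coeff m q = 0) : q = 0 := by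
  suffices h : ∀ k : ℕ, ∀ m : Option (Fin d) →₀ ℕ, m none = k → coeff m q = 0 by
    ext m
    simpa using h _ m rfl
  intro k
  induction k with
  | zero => exact h0
  | succ k ih =>
    intro m hm
    obtain ⟨m', rfl⟩ : ∃ m', m = m' + Finsupp.single none 1 := by
      refine ⟨m - Finsupp.single none 1, (tsub_add_cancel_of_le ?_).symm⟩
      rw [Finsupp.single_le_iff]
      omega
    have hm' : m' none = k := by simpa using hm
    have h := congrArg (coeff m') hq
    rw [schrodingerOp_apply] at h
    simp only [coeff_add, coeff_smul, coeff_sum, coeff_pderiv, coeff_zero] at h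
    rw [Finset.sum_eq_zero] at h
    · have hk : (m' none : ℂ) + 1 ≠ 0 := Nat.cast_add_one_ne_zero _
      simpa [hk] using h
    · intro ℓ _
      rw [ih]
      · simp
      · simpa using hm'

/-- Restriction of a polynomial in `(x, t)` to `t = 0`. -/
def initialValue (d : ℕ) :
    MvPolynomial (Option (Fin d)) ℂ →ₐ[ℂ] MvPolynomial (Fin d) ℂ :=
  aeval fun o => o.elim 0 X

theorem coeff_initialValue (d : ℕ) (q : MvPolynomial (Option (Fin d)) ℂ) (m : Fin d →₀ ℕ) :
    coeff m (initialValue d q) = coeff (m.optionElim 0) q := by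
  have h : initialValue d q = (optionEquivLeft ℂ (Fin d) q).coeff 0 := by
    rw [Polynomial.coeff_zero_eq_aeval_zero]
    refine DFunLike.congr_fun (f := initialValue d)
      (g := ((Polynomial.aeval (0 : MvPolynomial (Fin d) ℂ)).restrictScalars ℂ).comp
        (optionEquivLeft ℂ (Fin d)).toAlgHom) ?_ q
    ext o
    cases o <;> simp [initialValue]
  rw [h, ← optionEquivLeft_coeff_some_coeff_none]
  simp

theorem initialValue_rename (d : ℕ) (f : MvPolynomial (Fin d) ℂ) :
    initialValue d (rename some f) = f := by
  rw [initialValue, aeval_rename]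
  exact aeval_X_left_apply f

theorem totalDegree_initialValue_le (d : ℕ) (q : MvPolynomial (Option (Fin d)) ℂ) :
    (initialValue d q).totalDegree ≤ q.totalDegree := by
  refine Finset.sup_le fun m hm => ?_
  rw [mem_support_iff, coeff_initialValue] at hm
  refine le_trans (le_of_eq ?_) (le_totalDegree (mem_support_iff.2 hm))
  rw [Finsupp.sum_option_index _ _ (fun _ => rfl) (fun _ _ _ => rfl)]
  simp

/-- The `k`-th term `(t^k / k!) ((i/2) Δ)^k f` of the Schrödinger evolution of `f`. -/
def evolutionTerm (d : ℕ) (f : MvPolynomial (Fin d) ℂ) (k : ℕ) :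
    MvPolynomial (Option (Fin d)) ℂ :=
  ((Complex.I / 2) ^ k / (k.factorial : ℂ)) •
    (X none ^ k * rename some ((laplacianOp d ^ k) f))

theorem pderiv_none_rename_some (d : ℕ) (f : MvPolynomial (Fin d) ℂ) :
    pderiv none (rename some f : MvPolynomial (Option (Fin d)) ℂ) = 0 := by
  classical
  refine pderiv_eq_zero_of_notMem_vars fun h => ?_
  have := vars_rename some f h
  simp at this

theorem pderiv_none_evolutionTerm_zero (d : ℕ) (f : MvPolynomial (Fin d) ℂ) :
    pderiv none (evolutionTerm d f 0) = 0 := by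
  simp [evolutionTerm, pderiv_none_rename_some]

theorem sum_pderiv_some_X_none_pow_mul_rename (d k : ℕ) (g : MvPolynomial (Fin d) ℂ) :
    ∑ ℓ : Fin d, pderiv (some ℓ) (pderiv (some ℓ)
      (X none ^ k * rename some g : MvPolynomial (Option (Fin d)) ℂ)) =
      X none ^ k * rename some (laplacianOp d g) := by
  have h (ℓ : Fin d) (g : MvPolynomial (Fin d) ℂ) : pderiv (some ℓ)
      (X none ^ k * rename some g : MvPolynomial (Option (Fin d)) ℂ) =
      X none ^ k * rename some (pderiv ℓ g) := by
    rw [pderiv_mul, pderiv_pow, pderiv_X_of_ne (by simp),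
      pderiv_rename (Option.some_injective _)]
    simp
  simp [h, laplacianOp, Finset.mul_sum]

theorem pderiv_none_evolutionTerm_succ (d : ℕ) (f : MvPolynomial (Fin d) ℂ) (k : ℕ) :
    Complex.I • pderiv none (evolutionTerm d f (k + 1)) = -((1/2 : ℂ) •
      ∑ ℓ : Fin d, pderiv (some ℓ) (pderiv (some ℓ) (evolutionTerm d f k))) := by
  have hc : Complex.I * ((Complex.I / 2) ^ (k + 1) / ((k + 1).factorial : ℂ)) * ((k : ℂ) + 1) =
      -((1/2) * ((Complex.I / 2) ^ k / (k.factorial : ℂ))) := by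
    have hf : (k.factorial : ℂ) ≠ 0 := by exact_mod_cast k.factorial_ne_zero
    rw [Nat.factorial_succ, pow_succ]
    push_cast
    field_simp
    simp
  have hX : pderiv none (X none ^ (k + 1) * rename some ((laplacianOp d ^ (k + 1)) f) :
      MvPolynomial (Option (Fin d)) ℂ) =
      ((k : ℂ) + 1) • (X none ^ k * rename some ((laplacianOp d ^ (k + 1)) f)) := by
    rw [pderiv_mul, pderiv_pow, pderiv_X_self, pderiv_none_rename_some, smul_eq_C_mul]
    simp
    ring
  simp only [evolutionTerm, Derivation.map_smul, ← Finset.smul_sum, sum_pderiv_some_X_none_pow_mul_rename]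
  rw [hX, smul_smul, smul_smul, hc, smul_smul, neg_smul, pow_succ',
    Module.End.mul_apply]

theorem schrodingerOp_sum_evolutionTerm (d : ℕ) (f : MvPolynomial (Fin d) ℂ) (n : ℕ) :
    schrodingerOp d (∑ k ∈ Finset.range (n + 1), evolutionTerm d f k) =
      (1/2 : ℂ) • ∑ ℓ : Fin d, pderiv (some ℓ) (pderiv (some ℓ) (evolutionTerm d f n)) := by
  induction n with
  | zero => simp [schrodingerOp_apply, pderiv_none_evolutionTerm_zero]
  | succ n ih =>
    rw [Finset.sum_range_succ, map_add, ih, schrodingerOp_apply,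
      pderiv_none_evolutionTerm_succ]
    abel

theorem laplacianOp_pow_eq_zero (d n : ℕ) (f : MvPolynomial (Fin d) ℂ)
    (hf : f.totalDegree ≤ n) (k : ℕ) (hk : n < 2 * k) : (laplacianOp d ^ k) f = 0 := by
  ext m
  rw [coeff_laplacianOp_pow d n f hf k m (by omega), coeff_zero]

theorem totalDegree_evolutionTerm_le (d n : ℕ) (f : MvPolynomial (Fin d) ℂ)
    (hf : f.totalDegree ≤ n) (k : ℕ) : (evolutionTerm d f k).totalDegree ≤ n := by
  by_cases hk : n < 2 * k
  · simp [evolutionTerm, laplacianOp_pow_eq_zero d n f hf k hk]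
  · have h : ((laplacianOp d ^ k) f).totalDegree ≤ n - 2 * k := by
      refine Finset.sup_le fun m hm => ?_
      by_contra hlt
      refine mem_support_iff.1 hm (coeff_laplacianOp_pow d n f hf k m ?_)
      change ¬ m.degree ≤ _ at hlt
      omega
    have hX : (X none ^ k : MvPolynomial (Option (Fin d)) ℂ).totalDegree ≤ k := by
      simp
    have hmul := (totalDegree_smul_le ((Complex.I / 2) ^ k / (k.factorial : ℂ)) _).trans
      (totalDegree_mul (X none ^ k) (rename some ((laplacianOp d ^ k) f)))
    have hr := totalDegree_rename_le (some : Fin d → Option (Fin d)) ((laplacianOp d ^ k) f)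
    unfold evolutionTerm
    omega

theorem initialValue_sum_evolutionTerm (d n : ℕ) (f : MvPolynomial (Fin d) ℂ) :
    initialValue d (∑ k ∈ Finset.range (n + 1), evolutionTerm d f k) = f := by
  have h (k : ℕ) : initialValue d (evolutionTerm d f (k + 1)) = 0 := by
    simp [evolutionTerm, initialValue]
  rw [Finset.sum_range_succ', map_add, map_sum, Finset.sum_eq_zero fun k _ => h k]
  simp [evolutionTerm, initialValue_rename]

/-- Restriction to `t = 0` identifies the Trefftz space with the polynomials of total degree at
most `2p` in the space variables. -/
def trefftzSpaceEquiv (d p : ℕ) : trefftzSpace d p ≃ₗ[ℂ] restrictTotalDegree (Fin d) ℂ (2 * p) :=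
  LinearEquiv.ofBijective
    ((initialValue d).toLinearMap.restrict (p := trefftzSpace d p) fun q hq =>
      (mem_restrictTotalDegree _ _ _).2 <|
        (totalDegree_initialValue_le d q).trans ((mem_restrictTotalDegree _ _ _).1 hq.1))
    (by
      constructor
      · refine (injective_iff_map_eq_zero _).2 fun q hq => Subtype.ext ?_
        refine eq_zero_of_schrodingerOp_eq_zero d q q.2.2 fun m hm => ?_
        have h : initialValue d q = 0 := congrArg Subtype.val hq
        rw [← m.optionElim_some, hm, ← coeff_initialValue, h, coeff_zero]
      · rintro ⟨f, hf⟩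
        rw [mem_restrictTotalDegree] at hf
        refine ⟨⟨∑ k ∈ Finset.range (2 * p + 1), evolutionTerm d f k, ?_, ?_⟩,
          Subtype.ext (initialValue_sum_evolutionTerm d _ f)⟩
        · exact Submodule.sum_mem _ fun k _ => (mem_restrictTotalDegree _ _ _).2
            (totalDegree_evolutionTerm_le d _ f hf k)
        · change schrodingerOp d _ = 0
          rw [schrodingerOp_sum_evolutionTerm]
          have h := laplacianOp_pow_eq_zero d _ f hf (2 * p + 1) (by omega)
          rw [pow_succ', Module.End.mul_apply] at h
          simp only [evolutionTerm, Derivation.map_smul, ← Finset.smul_sum,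
            sum_pderiv_some_X_none_pow_mul_rename, h, map_zero, mul_zero, smul_zero])

/-- The `ℂ`-vector space of Trefftz polynomials of total degree at most `2p` in `(x, t)` has
dimension `C(2p + d, d)`, the dimension of the space of polynomials of total degree at most
`2p` in `d` variables. -/
theorem trefftzSpace_finrank (d p : ℕ) (hd : 1 ≤ d) :
    Module.finrank ℂ ↥(trefftzSpace d p) = Nat.choose (2 * p + d) d := by
  rw [(trefftzSpaceEquiv d p).finrank_eq, finrank_restrictTotalDegree]
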